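/- (Corollary 3.1, uniformity of the combined p-value with Gaussian overrunning.) Let (Ω, μ) be a probability space, let X : Ω → 𝒳 be a measurable map into a measurable space 𝒳, let Y : Ω → ℝ be a random variable, and let t_o : 𝒳 → ℝ be measurable with t_o(X) > 0 almost surely. Fix δ₀ ∈ ℝ and suppose: (i) P₁ := p₁(X; δ₀) takes values in (0,1), is σ(X)-measurable, and is uniformly distributed on (0,1) under μ; and (ii) the conditional distribution of Y given X under μ is the Gaussian measure with mean δ₀·t_o(X) and variance t_o(X) (i.e., the conditional distribution kernel of Y given X is x ↦ gaussianReal (δ₀·t_o(x)) (t_o(x))). Let w₁, w₂ be positive constants with w₁² + w₂² = 1. Then the combined p-value P = Φ̄( w₁·z(P₁) + w₂·(Y − δ₀·t_o(X))/√(t_o(X)) ) is uniformly distributed on (0,1) under μ. -/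

import Mathlib

open MeasureTheory ProbabilityTheory Set

/-- The cumulative distribution function `Φ` of the standard Gaussian measure on `ℝ`. -/
noncomputable def stdGaussCDF (x : ℝ) : ℝ := ((gaussianReal 0 1) (Set.Iic x)).toReal

/-- The survival function `Φ̄ = 1 - Φ` of the standard Gaussian measure. -/
noncomputable def stdGaussSurv (x : ℝ) : ℝ := 1 - stdGaussCDF x

/-- `z(u) = Φ̄⁻¹(u)`, the inverse of the standard Gaussian survival function. -/
noncomputable def zval : ℝ → ℝ := Function.invFun stdGaussSurv

/-- The uniform distribution on `(0,1)`: Lebesgue measure restricted to `(0,1)`. -/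
noncomputable def unif01 : Measure ℝ := volume.restrict (Set.Ioo (0 : ℝ) 1)

lemma aux_cdf_eq : stdGaussCDF = cdf (gaussianReal 0 1) := by
  funext x
  rw [cdf_eq_real]; rfl

lemma aux_nsc : NullSingletonClass (gaussianReal 0 1) :=
  nullSingletonClass_gaussianReal one_ne_zero

lemma aux_cdf_cont : Continuous stdGaussCDF := by
  rw [aux_cdf_eq, continuous_iff_continuousAt]
  intro x
  rw [(monotone_cdf _).continuousAt_iff_leftLim_eq_rightLim, StieltjesFunction.rightLim_eq]
  have h := StieltjesFunction.measure_singleton (cdf (gaussianReal 0 1)) x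
  have := aux_nsc
  rw [measure_cdf, measure_singleton] at h
  have h2 := ENNReal.ofReal_eq_zero.1 h.symm
  have h3 := (monotone_cdf (gaussianReal 0 1)).leftLim_le (le_refl x)
  linarith

lemma aux_cdf_strictMono : StrictMono stdGaussCDF := by
  intro x y hxy
  unfold stdGaussCDF
  have h1 : (gaussianReal 0 1) (Ioc x y) ≠ 0 := by
    intro h
    have := gaussianReal_absolutelyContinuous' 0 one_ne_zero h
    simp at this
    linarith
  have h2 : Iic y = Iic x ∪ Ioc x y := (Iic_union_Ioc_eq_Iic hxy.le).symm
  rw [h2, measure_union (by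
    rw [Set.disjoint_left]; intro z hz hz'; exact absurd hz'.1 (not_lt.2 hz)) measurableSet_Ioc,
    ENNReal.toReal_add (measure_ne_top _ _) (measure_ne_top _ _)]
  have := ENNReal.toReal_pos h1 (measure_ne_top _ _)
  linarith

lemma aux_S_cont : Continuous stdGaussSurv := continuous_const.sub aux_cdf_cont

lemma aux_S_anti : StrictAnti stdGaussSurv := fun x y h => by
  have := aux_cdf_strictMono h
  unfold stdGaussSurv; linarith

lemma aux_S_atTop : Filter.Tendsto stdGaussSurv Filter.atTop (nhds 0) := by
  have h := (tendsto_cdf_atTop (gaussianReal 0 1)).const_sub 1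
  rw [← aux_cdf_eq, sub_self] at h
  exact h

lemma aux_S_atBot : Filter.Tendsto stdGaussSurv Filter.atBot (nhds 1) := by
  have h := (tendsto_cdf_atBot (gaussianReal 0 1)).const_sub 1
  rw [← aux_cdf_eq, sub_zero] at h
  exact h

lemma aux_S_mem (x : ℝ) : stdGaussSurv x ∈ Ioo (0:ℝ) 1 := by
  constructor
  · have := aux_S_anti.antitone.le_of_tendsto aux_S_atTop (x + 1)
    have := aux_S_anti (lt_add_one x)
    linarith
  · have := aux_S_anti.antitone.ge_of_tendsto aux_S_atBot (x - 1)
    have := aux_S_anti (sub_one_lt x)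
    linarith

lemma aux_S_surj {u : ℝ} (hu : u ∈ Ioo (0:ℝ) 1) : ∃ x, stdGaussSurv x = u := by
  obtain ⟨a, ha⟩ := (aux_S_atTop.eventually_lt_const hu.1).exists
  obtain ⟨b, hb⟩ := (aux_S_atBot.eventually_const_lt hu.2).exists
  exact mem_range_of_exists_le_of_exists_ge aux_S_cont ⟨a, ha.le⟩ ⟨b, hb.le⟩

lemma aux_map_S : (gaussianReal 0 1).map stdGaussSurv = unif01 := by
  have hm := aux_S_cont.measurable
  have := Measure.isProbabilityMeasure_map (μ := gaussianReal 0 1) hm.aemeasurable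
  apply Measure.ext_of_Iic
  intro u
  rw [Measure.map_apply hm measurableSet_Iic, unif01, Measure.restrict_apply measurableSet_Iic]
  rcases le_or_gt u 0 with h0 | h0
  · have e1 : stdGaussSurv ⁻¹' Iic u = ∅ := by
      ext x; have := (aux_S_mem x).1; simp; linarith
    have e2 : Iic u ∩ Ioo (0:ℝ) 1 = ∅ := by
      ext x; simp; intros; linarith
    simp [e1, e2]
  rcases le_or_gt 1 u with h1 | h1
  · have e1 : stdGaussSurv ⁻¹' Iic u = univ := by
      ext x; have := (aux_S_mem x).2; simp; linarith
    have e2 : Iic u ∩ Ioo (0:ℝ) 1 = Ioo 0 1 := by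
      ext x; simp; intros; linarith
    simp [e1, e2]
  obtain ⟨x, rfl⟩ := aux_S_surj ⟨h0, h1⟩
  have e1 : stdGaussSurv ⁻¹' Iic (stdGaussSurv x) = Ici x := by
    ext y; simp [aux_S_anti.le_iff_ge]
  have e2 : Iic (stdGaussSurv x) ∩ Ioo (0:ℝ) 1 = Ioc 0 (stdGaussSurv x) := by
    ext y; simp only [mem_inter_iff, mem_Iic, mem_Ioo, mem_Ioc]
    constructor
    · rintro ⟨a, b, c⟩; exact ⟨b, a⟩
    · rintro ⟨a, b⟩; exact ⟨b, a, by linarith⟩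
  have := aux_nsc
  rw [e1, e2, Real.volume_Ioc, sub_zero, ← measure_congr Ioi_ae_eq_Ici, ← compl_Iic,
    prob_compl_eq_one_sub measurableSet_Iic, stdGaussSurv, stdGaussCDF,
    ENNReal.ofReal_sub _ ENNReal.toReal_nonneg, ENNReal.ofReal_toReal (measure_ne_top _ _),
    ENNReal.ofReal_one]

lemma aux_z_left (x : ℝ) : zval (stdGaussSurv x) = x :=
  Function.leftInverse_invFun aux_S_anti.injective x

lemma aux_z_meas : Measurable zval := by
  have he : MeasurableEmbedding stdGaussSurv :=
    aux_S_cont.measurableEmbedding aux_S_anti.injective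
  have hz : zval = Function.extend stdGaussSurv id
      (fun _ => Classical.choice (inferInstance : Nonempty ℝ)) := by
    funext u
    by_cases h : ∃ x, stdGaussSurv x = u
    · obtain ⟨x, rfl⟩ := h
      rw [aux_z_left, aux_S_anti.injective.extend_apply]; rfl
    · rw [Function.extend_apply' _ _ _ h, zval, Function.invFun_neg h]
  rw [hz]
  exact he.measurable_extend measurable_id measurable_const

lemma aux_map_z : unif01.map zval = gaussianReal 0 1 := by
  rw [← aux_map_S, Measure.map_map aux_z_meas aux_S_cont.measurable]
  have : zval ∘ stdGaussSurv = id := funext aux_z_left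
  rw [this, Measure.map_id]

lemma aux_std (δ t : ℝ) (ht : 0 < t) :
    (gaussianReal (δ * t) (Real.toNNReal t)).map (fun y => (y - δ * t) / Real.sqrt t)
      = gaussianReal 0 1 := by
  have h : (fun y : ℝ => (y - δ * t) / Real.sqrt t)
      = (fun y => y / Real.sqrt t) ∘ (fun y => y - δ * t) := rfl
  rw [h, ← Measure.map_map (by fun_prop) (by fun_prop), gaussianReal_map_sub_const,
    gaussianReal_map_div_const]
  congr 1
  · simp
  · ext
    simp [Real.sq_sqrt ht.le, ht.le, ht.ne']

theorem stmt10 {Ω 𝒳 : Type*} [MeasurableSpace Ω] [MeasurableSpace 𝒳]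
    (μ : Measure Ω) [IsProbabilityMeasure μ]
    (X : Ω → 𝒳) (hX : Measurable X)
    (Y : Ω → ℝ) (hY : Measurable Y)
    (t_o : 𝒳 → ℝ) (ht_o : Measurable t_o) (ht_opos : ∀ᵐ ω ∂μ, 0 < t_o (X ω))
    (δ₀ : ℝ) (P₁ : Ω → ℝ)
    (hP₁m : Measurable[MeasurableSpace.comap X inferInstance] P₁)
    (hP₁val : ∀ ω, P₁ ω ∈ Set.Ioo (0 : ℝ) 1)
    (hP₁unif : μ.map P₁ = unif01)
    (hcond : ∀ᵐ x ∂(μ.map X),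
      condDistrib Y X μ x = gaussianReal (δ₀ * t_o x) (Real.toNNReal (t_o x)))
    (w₁ w₂ : ℝ) (hw₁ : 0 < w₁) (hw₂ : 0 < w₂) (hw : w₁ ^ 2 + w₂ ^ 2 = 1) :
    μ.map (fun ω => stdGaussSurv (w₁ * zval (P₁ ω) +
      w₂ * ((Y ω - δ₀ * t_o (X ω)) / Real.sqrt (t_o (X ω))))) = unif01 := by
  obtain ⟨g, hg, rfl⟩ := hP₁m.exists_eq_measurable_comp
  set W : Ω → ℝ := fun ω => (Y ω - δ₀ * t_o (X ω)) / Real.sqrt (t_o (X ω)) with hW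
  have hWm : Measurable W := by fun_prop
  have hpos : ∀ᵐ x ∂(μ.map X), 0 < t_o x :=
    (ae_map_iff hX.aemeasurable (measurableSet_lt measurable_const ht_o)).2 ht_opos
  have := Measure.isProbabilityMeasure_map (μ := μ) hX.aemeasurable
  have hjoint : μ.map (fun ω => (X ω, W ω)) = (μ.map X).prod (gaussianReal 0 1) := by
    have hF : Measurable (fun p : 𝒳 × ℝ => (p.1, (p.2 - δ₀ * t_o p.1) / Real.sqrt (t_o p.1))) := by
      fun_prop
    have e : μ.map (fun ω => (X ω, W ω)) = (μ.map (fun ω => (X ω, Y ω))).map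
        (fun p : 𝒳 × ℝ => (p.1, (p.2 - δ₀ * t_o p.1) / Real.sqrt (t_o p.1))) := by
      rw [Measure.map_map hF (hX.prodMk hY)]; rfl
    rw [e, ← compProd_map_condDistrib hY.aemeasurable]
    ext s hs
    rw [Measure.map_apply hF hs, Measure.compProd_apply (hF hs), Measure.prod_apply hs]
    apply lintegral_congr_ae
    filter_upwards [hcond, hpos] with x hx hx0
    rw [hx, ← aux_std δ₀ (t_o x) hx0,
      Measure.map_apply (by fun_prop) (measurable_prodMk_left hs)]
    rfl
  have hWlaw : μ.map W = gaussianReal 0 1 := by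
    have e := congrArg (Measure.map Prod.snd) hjoint
    rw [Measure.map_map measurable_snd (hX.prodMk hWm), Measure.map_snd_prod] at e
    simpa [Function.comp_def] using e
  have hind : IndepFun X W μ := by
    rw [indepFun_iff_map_prod_eq_prod_map_map hX.aemeasurable hWm.aemeasurable, hjoint, hWlaw]
  have hz := aux_z_meas
  have hA : μ.map (fun ω => zval (g (X ω))) = gaussianReal 0 1 := by
    rw [← aux_map_z, ← hP₁unif, Measure.map_map hz (hg.comp hX)]; rfl
  have hA' : μ.map (fun ω => w₁ * zval (g (X ω))) = _ :=
    (gaussianReal_const_mul ⟨by fun_prop, hA⟩ w₁).map_eq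
  have hB' : μ.map (fun ω => w₂ * W ω) = _ :=
    (gaussianReal_const_mul ⟨by fun_prop, hWlaw⟩ w₂).map_eq
  have hind' : IndepFun (fun ω => w₁ * zval (g (X ω))) (fun ω => w₂ * W ω) μ :=
    hind.comp (φ := fun x => w₁ * zval (g x)) (ψ := fun y => w₂ * y) (by fun_prop) (by fun_prop)
  have hsum := gaussianReal_add_gaussianReal_of_indepFun hind' hA' hB'
  have hv : gaussianReal (w₁ * 0 + w₂ * 0)
      (NNReal.mk (w₁ ^ 2) (sq_nonneg _) * 1 + NNReal.mk (w₂ ^ 2) (sq_nonneg _) * 1)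
      = gaussianReal 0 1 := by
    congr 1
    · simp
    · ext; simpa using hw
  have hsum2 := hsum.trans hv
  rw [← aux_map_S, ← hsum2, Measure.map_map aux_S_cont.measurable (by fun_prop)]
  rfl
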